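/- For every even integer k ≥ 10 and every set S of vertices of H_k with |S| ≤ 4, the subgraph of H_k induced on the complement of S is connected. In particular, S is not a separator of H_k. -/

import Mathlib

open SimpleGraph

/-- Vertex type of the graph `H_k`: four disjoint families
`b_i` (`i` mod `k`), `u_j` (`j` mod `3k`), `v_j` (`j` mod `3k`), `a_i` (`i` mod `k`). -/
inductive HkV (k : ℕ) : Type where
  | b : ZMod k → HkV k
  | u : ZMod (3 * k) → HkV k
  | v : ZMod (3 * k) → HkV k
  | a : ZMod k → HkV k
deriving DecidableEq

/-- The natural map sending the residue `i` mod `k` to the residue `3 i` mod `3 k`. -/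
def HkV.tr (k : ℕ) (i : ZMod k) : ZMod (3 * k) := 3 * (i.val : ZMod (3 * k))

/-- The base edge relation of `H_k`: the four cycles
`b_1 ⋯ b_k`, `u_1 ⋯ u_{3k}`, `v_1 ⋯ v_{3k}`, `a_1 ⋯ a_k`, together with the edges
`b_i u_{3i-2}`, `b_i u_{3i}`, `b_i u_{3i+2}`, the edges `u_j v_{j-1}`, `u_j v_{j+1}`,
and the edges `a_i v_{3i-2}`, `a_i v_{3i}`, `a_i v_{3i+2}` (indices modulo `k`
resp. `3k`). -/
def hkRel (k : ℕ) : HkV k → HkV k → Prop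
  | .b i, .b i' => i' = i + 1
  | .u j, .u j' => j' = j + 1
  | .v j, .v j' => j' = j + 1
  | .a i, .a i' => i' = i + 1
  | .b i, .u j => j = HkV.tr k i - 2 ∨ j = HkV.tr k i ∨ j = HkV.tr k i + 2
  | .u j, .v j' => j' = j - 1 ∨ j' = j + 1
  | .a i, .v j => j = HkV.tr k i - 2 ∨ j = HkV.tr k i ∨ j = HkV.tr k i + 2
  | _, _ => False

/-- The graph `H_k` from the paper. -/
def Hk (k : ℕ) : SimpleGraph (HkV k) := SimpleGraph.fromRel (hkRel k)

namespace HkV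

variable {k : ℕ}

instance [NeZero k] : Finite (HkV k) := by
  let f : (ZMod k ⊕ ZMod (3 * k)) ⊕ (ZMod (3 * k) ⊕ ZMod k) → HkV k :=
    Sum.elim (Sum.elim .b .u) (Sum.elim .v .a)
  refine Finite.of_surjective f ?_
  rintro (i | j | j | i)
  exacts [⟨.inl (.inl i), rfl⟩, ⟨.inl (.inr j), rfl⟩, ⟨.inr (.inl j), rfl⟩, ⟨.inr (.inr i), rfl⟩]

/-- A set of vertices has as many elements as its traces on the four families together. -/
theorem ncard_eq_sum_preimages [NeZero k] (S : Set (HkV k)) :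
    S.ncard = (HkV.b ⁻¹' S).ncard + (HkV.u ⁻¹' S).ncard +
      ((HkV.v ⁻¹' S).ncard + (HkV.a ⁻¹' S).ncard) := by
  have hS : S = (HkV.b '' (HkV.b ⁻¹' S) ∪ HkV.u '' (HkV.u ⁻¹' S)) ∪
      (HkV.v '' (HkV.v ⁻¹' S) ∪ HkV.a '' (HkV.a ⁻¹' S)) := by
    ext (i | j | j | i) <;> simp
  conv_lhs => rw [hS]
  rw [Set.ncard_union_eq, Set.ncard_union_eq, Set.ncard_union_eq,
    Set.ncard_image_of_injective _ (fun _ _ h => HkV.b.inj h),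
    Set.ncard_image_of_injective _ (fun _ _ h => HkV.u.inj h),
    Set.ncard_image_of_injective _ (fun _ _ h => HkV.v.inj h),
    Set.ncard_image_of_injective _ (fun _ _ h => HkV.a.inj h)]
  all_goals
    rw [Set.disjoint_left]
    rintro (i | j | j | i) <;> simp

theorem tr_natCast [NeZero k] (m : ℕ) : tr k (m : ZMod k) = ((3 * m : ℕ) : ZMod (3 * k)) := by
  have h : tr k (m : ZMod k) = ((3 * (m % k) : ℕ) : ZMod (3 * k)) := by
    rw [tr, ZMod.val_natCast]
    push_cast
    rfl
  rw [h, ZMod.natCast_eq_natCast_iff]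
  exact (Nat.mod_modEq m k).mul_left' 3

theorem tr_injective [NeZero k] : Function.Injective (tr k) := by
  intro i i' h
  rw [← ZMod.natCast_zmod_val i, ← ZMod.natCast_zmod_val i', tr_natCast, tr_natCast,
    ZMod.natCast_eq_natCast_iff] at h
  have h' := Nat.ModEq.mul_left_cancel' (by norm_num) h
  rw [← ZMod.natCast_zmod_val i, ← ZMod.natCast_zmod_val i']
  exact (ZMod.natCast_eq_natCast_iff _ _ _).2 h'

theorem exists_eq_tr [NeZero k] (j : ZMod (3 * k)) :
    ∃ i : ZMod k, j = tr k i - 2 ∨ j = tr k i ∨ j = tr k i + 2 := by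
  rw [← ZMod.natCast_zmod_val j]
  generalize j.val = m
  obtain h | h | h : m = 3 * (m / 3) ∨ m + 2 = 3 * (m / 3 + 1) ∨ m = 3 * (m / 3) + 2 := by omega
  · refine ⟨(m / 3 : ℕ), .inr (.inl ?_)⟩
    rw [tr_natCast, ← h]
  · refine ⟨(m / 3 + 1 : ℕ), .inl ?_⟩
    rw [tr_natCast, ← h]
    push_cast
    ring
  · refine ⟨(m / 3 : ℕ), .inr (.inr ?_)⟩
    rw [tr_natCast]
    exact_mod_cast congrArg (Nat.cast (R := ZMod (3 * k))) h

/-- At most four vertices cannot meet all the disjoint paths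
`b_i`, `u_{3i}`, `v_{3i+1}`, `a_{i+1}`. -/
theorem exists_rung_notMem [NeZero k] {S : Set (HkV k)} (hS : S.ncard < k) :
    ∃ i : ZMod k, HkV.b i ∉ S ∧ HkV.u (tr k i) ∉ S ∧ HkV.v (tr k i + 1) ∉ S ∧
      HkV.a (i + 1) ∉ S := by
  by_contra! H
  have H' : ∀ i : ZMod k, ∃ s ∈ S, s = HkV.b i ∨ s = HkV.u (tr k i) ∨
      s = HkV.v (tr k i + 1) ∨ s = HkV.a (i + 1) := by
    intro i
    by_contra! h
    refine (h _ (H i ?_ ?_ ?_)).2.2.2 rfl <;> intro hs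
    exacts [(h _ hs).1 rfl, (h _ hs).2.1 rfl, (h _ hs).2.2.1 rfl]
  choose f hfS hf using H'
  have hinj : Function.Injective f := by
    intro i i' h
    rcases hf i with h1 | h1 | h1 | h1 <;> rcases hf i' with h2 | h2 | h2 | h2 <;>
      rw [h1, h2] at h <;> simp at h
    exacts [h, tr_injective h, tr_injective h, h]
  have hle : (f '' Set.univ).ncard ≤ S.ncard :=
    Set.ncard_le_ncard (by rintro _ ⟨i, -, rfl⟩; exact hfS i)
  rw [Set.ncard_image_of_injective _ hinj, Set.ncard_univ, Nat.card_zmod] at hle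
  omega

end HkV

/-- A cycle remains connected after deleting at most one vertex: a property invariant along the
surviving edges is constant on the surviving vertices. -/
theorem ZMod.iff_of_iff_succ_of_ncard_le_one {n : ℕ} [NeZero n] {D : Set (ZMod n)}
    (hD : D.ncard ≤ 1) {p : ZMod n → Prop}
    (hp : ∀ j, j ∉ D → j + 1 ∉ D → (p j ↔ p (j + 1))) {x y : ZMod n} (hx : x ∉ D) (hy : y ∉ D) :
    p x ↔ p y := by
  obtain ⟨d, hd⟩ : ∃ d, D ⊆ {d} := by
    rcases D.eq_empty_or_nonempty with rfl | ⟨d, hd⟩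
    · exact ⟨0, Set.empty_subset _⟩
    · exact ⟨d, fun e he => (Set.ncard_le_one D.toFinite).1 hD e he d hd⟩
  by_cases hdD : d ∈ D
  · have hne : ∀ m : ℕ, m + 1 < n → d + 1 + (m : ZMod n) ∉ D := by
      intro m hm hmem
      have h0 : ((m + 1 : ℕ) : ZMod n) = 0 := by
        have := hd hmem
        rw [Set.mem_singleton_iff] at this
        push_cast
        linear_combination this
      rw [ZMod.natCast_eq_zero_iff] at h0
      exact absurd (Nat.le_of_dvd (by omega) h0) (by omega)
    have hstep : ∀ m : ℕ, m + 1 < n → (p (d + 1) ↔ p (d + 1 + (m : ZMod n))) := by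
      intro m
      induction m with
      | zero => simp
      | succ m ih =>
        intro hm
        have e : d + 1 + ((m + 1 : ℕ) : ZMod n) = d + 1 + (m : ZMod n) + 1 := by push_cast; ring
        have h := hne (m + 1) hm
        rw [e] at h ⊢
        exact (ih (by omega)).trans (hp _ (hne m (by omega)) h)
    have hall : ∀ z, z ∉ D → (p (d + 1) ↔ p z) := by
      intro z hz
      have e : d + 1 + (((z - (d + 1)).val : ℕ) : ZMod n) = z := by
        rw [ZMod.natCast_zmod_val]
        ring
      have hlt : (z - (d + 1)).val + 1 < n := by
        refine lt_of_le_of_ne (ZMod.val_lt _) fun h => hz ?_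
        have h' : (((z - (d + 1)).val + 1 : ℕ) : ZMod n) = 0 := by rw [h, ZMod.natCast_self]
        rw [Nat.cast_add, ZMod.natCast_zmod_val, Nat.cast_one] at h'
        have hzd : z = d := by linear_combination h'
        exact hzd ▸ hdD
      have h := hstep _ hlt
      rwa [e] at h
    exact (hall x hx).symm.trans (hall y hy)
  · have hD' : ∀ z, z ∉ D := fun z hz => hdD (by rwa [← Set.mem_singleton_iff.1 (hd hz)])
    have hall : ∀ m : ℕ, p 0 ↔ p (m : ZMod n) := by
      intro m
      induction m with
      | zero => simp
      | succ m ih =>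
        rw [Nat.cast_succ]
        exact ih.trans (hp _ (hD' _) (hD' _))
    rw [← ZMod.natCast_zmod_val x, ← ZMod.natCast_zmod_val y]
    exact (hall _).symm.trans (hall _)

section Rings

variable {k : ℕ} [NeZero k] {B : Set (ZMod k)} {U V : Set (ZMod (3 * k))}
  {pb : ZMod k → Prop} {pu pv : ZMod (3 * k) → Prop} {c : Prop}

/-- Each surviving vertex of an inner ring has the value `c` as soon as the surviving vertices of
every ring with at most one deleted vertex have it. -/
theorem inner_ring_iff (hk : 2 ≤ k) (hcard : B.ncard + U.ncard + V.ncard ≤ 4)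
    (hB : B.ncard ≤ 1 → ∀ i ∉ B, (pb i ↔ c)) (hU : U.ncard ≤ 1 → ∀ j ∉ U, (pu j ↔ c))
    (hV : V.ncard ≤ 1 → ∀ j ∉ V, (pv j ↔ c))
    (hbu : ∀ i ∉ B, ∀ j ∉ U,
      (j = HkV.tr k i - 2 ∨ j = HkV.tr k i ∨ j = HkV.tr k i + 2) → (pb i ↔ pu j))
    (huv : ∀ j ∉ U, ∀ j' ∉ V, (j' = j - 1 ∨ j' = j + 1) → (pu j ↔ pv j')) :
    ∀ j ∉ U, (pu j ↔ c) := by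
  intro j hj
  by_cases hU1 : U.ncard ≤ 1
  · exact hU hU1 j hj
  by_cases hV1 : V.ncard ≤ 1
  · by_cases h1 : j - 1 ∈ V
    · have h2 : j + 1 ∉ V := by
        intro h2
        have h := (Set.ncard_le_one V.toFinite).1 hV1 _ h1 _ h2
        have h0 : ((2 : ℕ) : ZMod (3 * k)) = 0 := by
          push_cast
          linear_combination -h
        rw [ZMod.natCast_eq_zero_iff] at h0
        exact absurd (Nat.le_of_dvd (by omega) h0) (by omega)
      exact (huv j hj _ h2 (.inr rfl)).trans (hV hV1 _ h2)
    · exact (huv j hj _ h1 (.inl rfl)).trans (hV hV1 _ h1)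
  · obtain ⟨i, hi⟩ := HkV.exists_eq_tr j
    have hB0 : B = ∅ := (Set.ncard_eq_zero B.toFinite).1 (by omega)
    have hiB : i ∉ B := by simp [hB0]
    exact (hbu i hiB j hj hi).symm.trans (hB (by omega) i hiB)

/-- Each surviving vertex of an outer ring has the value `c` as soon as the surviving vertices of
the adjacent inner ring have it. -/
theorem outer_ring_iff (hk : 2 ≤ k) (hcard : B.ncard + U.ncard ≤ 4)
    (hB : B.ncard ≤ 1 → ∀ i ∉ B, (pb i ↔ c)) (hU : ∀ j ∉ U, (pu j ↔ c))
    (hbu : ∀ i ∉ B, ∀ j ∉ U,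
      (j = HkV.tr k i - 2 ∨ j = HkV.tr k i ∨ j = HkV.tr k i + 2) → (pb i ↔ pu j)) :
    ∀ i ∉ B, (pb i ↔ c) := by
  intro i hi
  by_cases hB1 : B.ncard ≤ 1
  · exact hB hB1 i hi
  obtain ⟨j, hj, hij⟩ : ∃ j ∉ U,
      j = HkV.tr k i - 2 ∨ j = HkV.tr k i ∨ j = HkV.tr k i + 2 := by
    by_contra! h
    have hmem : ∀ j, (j = HkV.tr k i - 2 ∨ j = HkV.tr k i ∨ j = HkV.tr k i + 2) → j ∈ U :=
      fun j hj => by_contra fun hjU => by have := h j hjU; tauto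
    have hne : ∀ m : ℕ, 0 < m → m < 3 * k → (m : ZMod (3 * k)) ≠ 0 := by
      intro m hm hmk h0
      rw [ZMod.natCast_eq_zero_iff] at h0
      exact absurd (Nat.le_of_dvd hm h0) (by omega)
    have h3 : 2 < U.ncard := by
      refine (Set.two_lt_ncard_iff U.toFinite).2 ⟨_, _, _, hmem _ (.inl rfl),
        hmem _ (.inr (.inl rfl)), hmem _ (.inr (.inr rfl)), fun e => ?_, fun e => ?_, fun e => ?_⟩
      · exact hne 2 (by omega) (by omega) (by push_cast; linear_combination -e)
      · exact hne 4 (by omega) (by omega) (by push_cast; linear_combination -e)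
      · exact hne 2 (by omega) (by omega) (by push_cast; linear_combination -e)
    omega
  exact (hbu i hi j hj hij).trans (hU j hj)

end Rings

/-- A property of the vertices of `H_k` that is invariant along the edges avoiding at most four
deleted vertices has the same truth value at all surviving vertices. -/
theorem HkV.exists_forall_iff {k : ℕ} (hk : 5 ≤ k) {S : Set (HkV k)} (hS : S.ncard ≤ 4)
    {P : HkV k → Prop} (hP : ∀ x ∉ S, ∀ y ∉ S, hkRel k x y → (P x ↔ P y)) :
    ∃ x₀ ∉ S, ∀ x ∉ S, (P x ↔ P x₀) := by
  have : NeZero k := ⟨by omega⟩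
  obtain ⟨i₀, hb₀, hu₀, hv₀, ha₀⟩ := exists_rung_notMem (S := S) (by omega)
  have hcard := ncard_eq_sum_preimages S
  have hu : P (.u (tr k i₀)) ↔ P (.b i₀) := (hP _ hb₀ _ hu₀ (.inr (.inl rfl))).symm
  have hv : P (.v (tr k i₀ + 1)) ↔ P (.b i₀) := (hP _ hu₀ _ hv₀ (.inr rfl)).symm.trans hu
  have htr : tr k (i₀ + 1) = tr k i₀ + 3 := by
    have h := tr_natCast (k := k) (i₀.val + 1)
    have h' := tr_natCast (k := k) i₀.val
    push_cast [ZMod.natCast_zmod_val] at h h'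
    rw [h, h']
    ring
  have ha : P (.a (i₀ + 1)) ↔ P (.b i₀) :=
    (hP _ ha₀ _ hv₀ (.inl (by rw [htr]; ring))).trans hv
  have hB : (HkV.b ⁻¹' S).ncard ≤ 1 → ∀ i ∉ HkV.b ⁻¹' S, (P (.b i) ↔ P (.b i₀)) :=
    fun h i hi => ZMod.iff_of_iff_succ_of_ncard_le_one (p := fun i => P (.b i)) h
      (fun j hj hj' => hP _ hj _ hj' rfl) hi hb₀
  have hU : (HkV.u ⁻¹' S).ncard ≤ 1 → ∀ j ∉ HkV.u ⁻¹' S, (P (.u j) ↔ P (.b i₀)) :=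
    fun h i hi => (ZMod.iff_of_iff_succ_of_ncard_le_one (p := fun i => P (.u i)) h
      (fun j hj hj' => hP _ hj _ hj' rfl) hi hu₀).trans hu
  have hV : (HkV.v ⁻¹' S).ncard ≤ 1 → ∀ j ∉ HkV.v ⁻¹' S, (P (.v j) ↔ P (.b i₀)) :=
    fun h i hi => (ZMod.iff_of_iff_succ_of_ncard_le_one (p := fun i => P (.v i)) h
      (fun j hj hj' => hP _ hj _ hj' rfl) hi hv₀).trans hv
  have hA : (HkV.a ⁻¹' S).ncard ≤ 1 → ∀ i ∉ HkV.a ⁻¹' S, (P (.a i) ↔ P (.b i₀)) :=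
    fun h i hi => (ZMod.iff_of_iff_succ_of_ncard_le_one (p := fun i => P (.a i)) h
      (fun j hj hj' => hP _ hj _ hj' rfl) hi ha₀).trans ha
  have hU' := inner_ring_iff (by omega) (by omega) hB hU hV
    (fun i hi j hj h => hP (.b i) hi (.u j) hj h) (fun j hj j' hj' h => hP (.u j) hj (.v j') hj' h)
  have hV' := inner_ring_iff (by omega) (by omega) hA hV hU
    (fun i hi j hj h => hP (.a i) hi (.v j) hj h)
    (fun j hj j' hj' h => (hP (.u j') hj' (.v j) hj
      (h.symm.imp (fun e => by rw [e]; ring) (fun e => by rw [e]; ring))).symm)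
  have hB' := outer_ring_iff (by omega) (by omega) hB hU'
    (fun i hi j hj h => hP (.b i) hi (.u j) hj h)
  have hA' := outer_ring_iff (by omega) (by omega) hA hV'
    (fun i hi j hj h => hP (.a i) hi (.v j) hj h)
  refine ⟨.b i₀, hb₀, ?_⟩
  rintro (i | j | j | i) hx
  exacts [hB' i hx, hU' j hx, hV' j hx, hA' i hx]

/-- for every even integer `k ≥ 10` and every set `S` of vertices of
`H_k` with `|S| ≤ 4`, the subgraph of `H_k` induced on the complement of `S` is
connected; in particular no such `S` is a separator of `H_k`. -/
theorem Hk_no_small_separator (k : ℕ) (hk : 10 ≤ k) (hke : Even k) :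
    ∀ S : Set (HkV k), S.ncard ≤ 4 → ((Hk k).induce Sᶜ).Connected := by
  intro S hS
  have hconst : ∀ x y (hx : x ∈ Sᶜ) (hy : y ∈ Sᶜ), ((Hk k).induce Sᶜ).Reachable ⟨x, hx⟩ ⟨y, hy⟩ := by
    intro x y hx hy
    obtain ⟨z, -, hz⟩ := HkV.exists_forall_iff (by omega) hS
      (P := fun z => ∃ h : z ∈ Sᶜ, ((Hk k).induce Sᶜ).Reachable ⟨x, hx⟩ ⟨z, h⟩) (by
        intro y hy z hz hyz
        by_cases hne : y = z
        · rw [hne]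
        have hadj : ((Hk k).induce Sᶜ).Adj ⟨y, hy⟩ ⟨z, hz⟩ :=
          (SimpleGraph.fromRel_adj _ _ _).2 ⟨hne, .inl hyz⟩
        exact ⟨fun ⟨_, h⟩ => ⟨hz, h.trans hadj.reachable⟩,
          fun ⟨_, h⟩ => ⟨hy, h.trans hadj.symm.reachable⟩⟩)
    exact ((hz y hy).2 ((hz x hx).1 ⟨hx, .rfl⟩)).2
  obtain ⟨x, hx, -⟩ := HkV.exists_forall_iff (P := fun _ => True) (by omega) hS (by simp)
  have : Nonempty ↥Sᶜ := ⟨⟨x, hx⟩⟩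
  exact ⟨fun x y => hconst x y x.2 y.2⟩
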